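/- The family {π(v_λ)}, as λ ranges over all partitions of n, spans the R-module V_n; equivalently, every element of V_n is an R-linear combination of the classes π(v_λ). In particular, for every braid β ∈ B_n, the class π(ρ(β)) in V_n is an R-linear combination of the classes π(v_λ). -/

import Mathlib

/-- The defining relations of the Iwahori–Hecke algebra `H_n` on generators
`T_1, …, T_{n-1}` (indexed by `i : Fin (n-1)`, with `i` standing for `T_{i+1}`). -/
inductive HeckeRel (R : Type) [CommRing R] (A B : Rˣ) (n : ℕ) :
    FreeAlgebra R (Fin (n - 1)) → FreeAlgebra R (Fin (n - 1)) → Prop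
  | comm (i j : Fin (n - 1)) (h : (i : ℕ) + 1 < (j : ℕ)) :
      HeckeRel R A B n (FreeAlgebra.ι R i * FreeAlgebra.ι R j)
        (FreeAlgebra.ι R j * FreeAlgebra.ι R i)
  | braid (i j : Fin (n - 1)) (h : (j : ℕ) = (i : ℕ) + 1) :
      HeckeRel R A B n (FreeAlgebra.ι R i * FreeAlgebra.ι R j * FreeAlgebra.ι R i)
        (FreeAlgebra.ι R j * FreeAlgebra.ι R i * FreeAlgebra.ι R j)
  | quad (i : Fin (n - 1)) :
      HeckeRel R A B n (FreeAlgebra.ι R i * FreeAlgebra.ι R i)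
        ((B : R) • FreeAlgebra.ι R i + algebraMap R (FreeAlgebra R (Fin (n - 1))) (A : R))

/-- The Iwahori–Hecke algebra `H_n`. -/
abbrev Hecke (R : Type) [CommRing R] (A B : Rˣ) (n : ℕ) : Type :=
  RingQuot (HeckeRel R A B n)

/-- The generator `T_{i+1}` of the Iwahori–Hecke algebra. -/
noncomputable def Tgen (R : Type) [CommRing R] (A B : Rˣ) (n : ℕ) (i : Fin (n - 1)) :
    Hecke R A B n :=
  RingQuot.mkAlgHom R (HeckeRel R A B n) (FreeAlgebra.ι R i)

/-- The braid relations defining the braid group `B_n` on the Artin generators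
`σ_1, …, σ_{n-1}` (indexed by `i : Fin (n-1)`, with `i` standing for `σ_{i+1}`). -/
def braidRels (n : ℕ) : Set (FreeGroup (Fin (n - 1))) :=
  {r | (∃ i j : Fin (n - 1), (i : ℕ) + 1 < (j : ℕ) ∧
          r = FreeGroup.of i * FreeGroup.of j * (FreeGroup.of i)⁻¹ * (FreeGroup.of j)⁻¹) ∨
       (∃ i j : Fin (n - 1), (j : ℕ) = (i : ℕ) + 1 ∧
          r = FreeGroup.of i * FreeGroup.of j * FreeGroup.of i *
            (FreeGroup.of j)⁻¹ * (FreeGroup.of i)⁻¹ * (FreeGroup.of j)⁻¹)}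

/-- The braid group `B_n`, as a presented group. -/
abbrev BraidGroup (n : ℕ) : Type := PresentedGroup (braidRels n)

/-- The `R`-submodule of `H_n` spanned by all commutators `x*y - y*x`. -/
def commSub (R : Type) [CommRing R] (A B : Rˣ) (n : ℕ) : Submodule R (Hecke R A B n) :=
  Submodule.span R {z : Hecke R A B n | ∃ x y : Hecke R A B n, z = x * y - y * x}

/-- The module `V_n`, the quotient of `H_n` by the span of all commutators. -/
abbrev Vmod (R : Type) [CommRing R] (A B : Rˣ) (n : ℕ) : Type :=
  Hecke R A B n ⧸ commSub R A B n

/-- The quotient map `π : H_n → V_n`. -/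
noncomputable def piV (R : Type) [CommRing R] (A B : Rˣ) (n : ℕ) :
    Hecke R A B n →ₗ[R] Vmod R A B n :=
  (commSub R A B n).mkQ

/-- `Tn R A B n t` is the generator `T_{t+1}` of `H_n` (for `t < n - 1`; junk value `1`
otherwise, which never occurs for the indices arising from partitions of `n`). -/
noncomputable def Tn (R : Type) [CommRing R] (A B : Rˣ) (n : ℕ) (t : ℕ) : Hecke R A B n :=
  if h : t < n - 1 then Tgen R A B n ⟨t, h⟩ else 1

/-- The descending block `T_{s+k-1} ⋯ T_{s+2} T_{s+1}` in 1-based labelling, i.e. the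
product of `Tn (s+k-2), …, Tn (s+1), Tn s` in descending order (empty for `k ≤ 1`).
Here `s` is the offset (partial sum of the previous parts). -/
noncomputable def blockH (R : Type) [CommRing R] (A B : Rˣ) (n : ℕ) (s k : ℕ) :
    Hecke R A B n :=
  ((List.range (k - 1)).map fun j => Tn R A B n (s + (k - 2 - j))).prod

/-- `vList R A B n s L` is the product of the descending blocks determined by the list of
parts `L`, starting at offset `s`: the braids `b_{(k)}` placed side by side. -/
noncomputable def vList (R : Type) [CommRing R] (A B : Rˣ) (n : ℕ) :
    ℕ → List ℕ → Hecke R A B n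
  | _, [] => 1
  | s, k :: L => blockH R A B n s k * vList R A B n (s + k) L

/-- The basis element `v_λ ∈ H_n` associated to a partition `λ` of `n`: the parts of `λ`
are listed in descending order `λ_1 ≥ λ_2 ≥ … ≥ λ_m` and the corresponding descending
blocks are placed side by side. -/
noncomputable def vPart (R : Type) [CommRing R] (A B : Rˣ) (n : ℕ) (p : Nat.Partition n) :
    Hecke R A B n :=
  vList R A B n 0 ((p.parts.sort (· ≤ ·)).reverse)

namespace HeckeAux

section Mon
variable {M : Type} [Monoid M] (T : ℕ → M)

/-- Submonoid generated by the generators on strands `a, …, b-1`. -/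
def S (a b : ℕ) : Submonoid M := Submonoid.closure {x | ∃ t, a ≤ t ∧ t + 1 < b ∧ x = T t}

lemma T_mem {a b t : ℕ} (h1 : a ≤ t) (h2 : t + 1 < b) : T t ∈ S T a b :=
  Submonoid.subset_closure ⟨t, h1, h2, rfl⟩

lemma S_mono {a b a' b' : ℕ} (h1 : a' ≤ a) (h2 : b ≤ b') : S T a b ≤ S T a' b' := by
  apply Submonoid.closure_mono
  rintro x ⟨t, h3, h4, rfl⟩
  exact ⟨t, by omega, by omega, rfl⟩

variable (hc : ∀ i j, i + 1 < j → Commute (T i) (T j))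
include hc

lemma S_comm {a b c d : ℕ} (h : b ≤ c) {x y : M} (hx : x ∈ S T a b) (hy : y ∈ S T c d) :
    Commute x y := by
  induction hx using Submonoid.closure_induction with
  | one => exact Commute.one_left _
  | mul u v _ _ hu hv => exact hu.mul_left hv
  | mem u hu =>
    obtain ⟨t, h1, h2, rfl⟩ := hu
    induction hy using Submonoid.closure_induction with
    | one => exact Commute.one_right _
    | mul u v _ _ hu hv => exact hu.mul_right hv
    | mem v hv =>
      obtain ⟨r, h3, h4, rfl⟩ := hv
      exact hc _ _ (by omega)

omit hc in
lemma S_unit (hu : ∀ i, IsUnit (T i)) {a b : ℕ} {x : M} (hx : x ∈ S T a b) : IsUnit x := by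
  induction hx using Submonoid.closure_induction with
  | one => exact isUnit_one
  | mul u v _ _ hu hv => exact hu.mul hv
  | mem u h => obtain ⟨t, _, _, rfl⟩ := h; exact hu t

omit hc in
/-- ascending product `T_t ⋯ T_{t+j-1}` -/
def asc (t : ℕ) : ℕ → M
  | 0 => 1
  | j + 1 => asc t j * T (t + j)

omit hc in
lemma asc_mem (t j : ℕ) : asc T t j ∈ S T t (t + j + 1) := by
  induction j with
  | zero => exact one_mem _
  | succ j ih =>
    exact mul_mem (S_mono T le_rfl (by omega) ih) (T_mem T (by omega) (by omega))

variable (N : ℕ) (hb : ∀ i, i + 1 < N → T i * T (i+1) * T i = T (i+1) * T i * T (i+1))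
include hb

lemma asc_shift (t j i : ℕ) (h : t + j ≤ N) (h1 : t ≤ i) (h2 : i + 1 < t + j) :
    asc T t j * T i = T (i+1) * asc T t j := by
  induction j with
  | zero => omega
  | succ j ih =>
    by_cases h3 : i + 1 < t + j
    · have e := ih (by omega) h3
      have c : Commute (T i) (T (t+j)) := hc _ _ (by omega)
      rw [asc, mul_assoc, ← c.eq, ← mul_assoc, e, mul_assoc]
    · cases j with
      | zero => omega
      | succ j =>
        have hi : i = t + j := by omega
        subst hi
        have c : Commute (asc T t j) (T (t+j+1)) :=
          S_comm T hc (b := t+j+1) le_rfl (asc_mem T t j) (T_mem T (b := t+j+3) le_rfl (by omega))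
        have b := hb (t+j) (by omega)
        simp only [asc, ← add_assoc]
        rw [mul_assoc, mul_assoc, ← mul_assoc (T (t+j)), b, ← mul_assoc, ← mul_assoc, c.eq]
        simp only [mul_assoc]

lemma asc_asc (t j : ℕ) (h : t + j < N) :
    asc T (t+1) j * asc T t j * T (t+j) = T t * (asc T (t+1) j * asc T t j) := by
  induction j with
  | zero => simp [asc]
  | succ j ih =>
    have e := ih (by omega)
    have c : Commute (asc T t j) (T (t+j+1)) :=
      S_comm T hc (b := t+j+1) le_rfl (asc_mem T t j) (T_mem T (b := t+j+3) le_rfl (by omega))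
    have b := hb (t+j) (by omega)
    have e1 : t + 1 + j = t + j + 1 := by omega
    simp only [asc, ← add_assoc, e1]
    calc asc T (t+1) j * T (t+j+1) * (asc T t j * T (t+j)) * T (t+j+1)
        = asc T (t+1) j * (T (t+j+1) * asc T t j) * T (t+j) * T (t+j+1) := by
          simp only [mul_assoc]
      _ = asc T (t+1) j * asc T t j * (T (t+j+1) * T (t+j) * T (t+j+1)) := by
          rw [← c.eq]; simp only [mul_assoc]
      _ = (asc T (t+1) j * asc T t j * T (t+j)) * T (t+j+1) * T (t+j) := by
          rw [← b]; simp only [mul_assoc]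
      _ = T t * asc T (t+1) j * (asc T t j * T (t+j+1)) * T (t+j) := by
          rw [e]; simp only [mul_assoc]
      _ = _ := by rw [c.eq]; simp only [mul_assoc]

omit hc hb in
/-- block crossing -/
def W (s j : ℕ) : ℕ → M
  | 0 => 1
  | k + 1 => asc T (s + k) j * W s j k

omit hc hb in
lemma W_mem (s j k : ℕ) : W T s j k ∈ S T s (s + j + k) := by
  induction k with
  | zero => exact one_mem _
  | succ k ih =>
    exact mul_mem (S_mono T (by omega) (by omega) (asc_mem T (s+k) j))
      (S_mono T le_rfl (by omega) ih)

lemma W_left (s j k i : ℕ) (h : s + j + k ≤ N + 1) (h1 : s ≤ i) (h2 : i + 1 < s + j) :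
    W T s j k * T i = T (i + k) * W T s j k := by
  induction k with
  | zero => simp [W]
  | succ k ih =>
    rw [W, mul_assoc, ih (by omega), ← mul_assoc,
      asc_shift T hc N hb (s+k) j (i+k) (by omega) (by omega) (by omega), mul_assoc, add_assoc]

lemma W_right (s j k i : ℕ) (h : s + j + k ≤ N + 1) (h2 : i + 1 < k) :
    W T s j k * T (s + j + i) = T (s + i) * W T s j k := by
  induction k with
  | zero => omega
  | succ k ih =>
    by_cases h3 : i + 1 < k
    · have c : Commute (T (s+i)) (asc T (s+k) j) :=
        S_comm T hc (a := s + i) (b := s + k) le_rfl (T_mem T le_rfl (by omega)) (asc_mem T _ _)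
      rw [W, mul_assoc, ih (by omega) h3, ← mul_assoc, ← c.eq, mul_assoc]
    · obtain rfl : k = i + 1 := by omega
      have c : Commute (W T s j i) (T (s+j+i)) :=
        S_comm T hc (b := s + j + i) le_rfl (W_mem T s j i)
          (T_mem T (b := s+j+i+2) le_rfl (by omega))
      have e := asc_asc T hc N hb (s+i) j (by omega)
      have e1 : s + i + j = s + j + i := by omega
      rw [e1] at e
      simp only [W, ← add_assoc]
      calc _ = asc T (s+i+1) j * asc T (s+i) j * (W T s j i * T (s+j+i)) := by
            simp only [mul_assoc]
        _ = (asc T (s+i+1) j * asc T (s+i) j * T (s+j+i)) * W T s j i := by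
            rw [c.eq]; simp only [mul_assoc]
        _ = _ := by rw [e]; simp only [mul_assoc]

omit hc hb in
/-- descending block -/
def blk (s k : ℕ) : M := ((List.range (k - 1)).map fun j => T (s + (k - 2 - j))).prod

omit hc hb in
lemma blk_zero (s : ℕ) : blk T s 0 = 1 := by simp [blk]

omit hc hb in
lemma blk_one (s : ℕ) : blk T s 1 = 1 := by simp [blk]

omit hc hb in
lemma blk_succ (s k : ℕ) : blk T s (k+2) = T (s + k) * blk T s (k+1) := by
  simp only [blk, Nat.add_sub_cancel, show k + 2 - 1 = k + 1 by omega,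
    List.range_succ_eq_map, List.map_cons, List.prod_cons, List.map_map, Nat.sub_zero]
  congr 2
  apply List.map_congr_left
  intro a _
  simp only [Function.comp]
  congr 2
  omega

omit hc hb in
lemma blk_succ' (s k : ℕ) : blk T s (k+2) = blk T (s+1) (k+1) * T s := by
  induction k with
  | zero => simp [blk_succ, blk_one]
  | succ k ih =>
    rw [blk_succ, ih, blk_succ, mul_assoc, show s + 1 + k = s + (k+1) by omega]

omit hc hb in
lemma blk_mem (s k : ℕ) : blk T s k ∈ S T s (s + k) := by
  rcases k with _ | k
  · rw [blk_zero]; exact one_mem _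
  · induction k with
    | zero => rw [blk_one]; exact one_mem _
    | succ k ih =>
      rw [blk_succ]
      exact mul_mem (T_mem T (by omega) (by omega)) (S_mono T le_rfl (by omega) ih)

omit hc hb in
lemma blk_conj (w : M) (s s' k : ℕ) (h : ∀ i, i + 1 < k → w * T (s + i) = T (s' + i) * w) :
    w * blk T s k = blk T s' k * w := by
  rcases k with _ | k
  · simp [blk_zero]
  · induction k with
    | zero => simp [blk_one]
    | succ k ih =>
      rw [blk_succ, blk_succ, ← mul_assoc, h k (by omega), mul_assoc,
        ih (fun i hi => h i (by omega)), mul_assoc]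

omit hc hb in
/-- blocks side by side -/
def vl : ℕ → List ℕ → M
  | _, [] => 1
  | s, k :: L => blk T s k * vl (s + k) L

omit hc hb in
lemma vl_mem (s : ℕ) (L : List ℕ) : vl T s L ∈ S T s (s + L.sum) := by
  induction L generalizing s with
  | nil => exact one_mem _
  | cons k L ih =>
    rw [vl, List.sum_cons]
    exact mul_mem (S_mono T le_rfl (by omega) (blk_mem T s k))
      (S_mono T (by omega) (by omega) (ih (s + k)))

omit hc hb in
lemma vl_append (s : ℕ) (L : List ℕ) (k : ℕ) :
    vl T s (L ++ [k]) = vl T s L * blk T (s + L.sum) k := by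
  induction L generalizing s with
  | nil => simp [vl]
  | cons a L ih => simp [vl, ih, mul_assoc, add_assoc]

lemma vl_perm {L L' : List ℕ} (p : L.Perm L') (s : ℕ) (h : s + L.sum ≤ N + 1) :
    ∃ w ∈ S T s (s + L.sum), w * vl T s L = vl T s L' * w := by
  induction p generalizing s with
  | nil => exact ⟨1, one_mem _, by simp⟩
  | cons k _ ih =>
    rw [List.sum_cons] at h
    obtain ⟨w, hw, e⟩ := ih (s + k) (by omega)
    refine ⟨w, S_mono T (by omega) (by simp [add_assoc]) hw, ?_⟩
    have c := S_comm T hc le_rfl (blk_mem T s k) hw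
    rw [vl, vl, ← mul_assoc, ← c.eq, mul_assoc, e, mul_assoc]
  | swap j k L =>
    simp only [List.sum_cons] at h
    refine ⟨W T s k j, S_mono T le_rfl (by simp only [List.sum_cons]; omega) (W_mem T s k j), ?_⟩
    have c := S_comm T hc (by omega) (W_mem T s k j) (vl_mem T (s + k + j) L)
    have e1 : W T s k j * blk T s k = blk T (s+j) k * W T s k j :=
      blk_conj T _ _ _ _ fun i hi => by
        rw [W_left T hc N hb s k j _ (by omega) (by omega) (by omega)]
        congr 2; omega
    have e2 : W T s k j * blk T (s+k) j = blk T s j * W T s k j :=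
      blk_conj T _ _ _ _ fun i hi => W_right T hc N hb s k j _ (by omega) (by omega)
    have c2 : Commute (blk T s j) (blk T (s+j) k) :=
      S_comm T hc le_rfl (blk_mem T s j) (blk_mem T (s+j) k)
    simp only [vl]
    have e3 : s + j + k = s + k + j := by omega
    calc W T s k j * (blk T s k * (blk T (s+k) j * vl T (s+k+j) L))
        = (W T s k j * blk T s k) * blk T (s+k) j * vl T (s+k+j) L := by simp only [mul_assoc]
      _ = blk T (s+j) k * (W T s k j * blk T (s+k) j) * vl T (s+k+j) L := by
          rw [e1]; simp only [mul_assoc]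
      _ = blk T (s+j) k * blk T s j * (W T s k j * vl T (s+k+j) L) := by
          rw [e2]; simp only [mul_assoc]
      _ = _ := by rw [c.eq, ← c2.eq, e3]; simp only [mul_assoc]
  | trans p q ih1 ih2 =>
    obtain ⟨w, hw, e⟩ := ih1 s h
    obtain ⟨w', hw', e'⟩ := ih2 s (by rw [← p.sum_eq]; exact h)
    rw [← p.sum_eq] at hw'
    exact ⟨w' * w, mul_mem hw' hw, by rw [mul_assoc, e, ← mul_assoc, e', mul_assoc]⟩

end Mon

section Alg
variable {R H V : Type} [CommRing R] [Ring H] [Algebra R H] [AddCommGroup V] [Module R V]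
  (T : ℕ → H)

/-- subalgebra generated by `T_t`, `t < k` -/
def adj (R : Type) {H : Type} [CommRing R] [Ring H] [Algebra R H] (T : ℕ → H) (k : ℕ) :
    Subalgebra R H := Algebra.adjoin R {x | ∃ t, t < k ∧ x = T t}

lemma T_adj {t k : ℕ} (h : t < k) : T t ∈ adj R T k := Algebra.subset_adjoin ⟨t, h, rfl⟩

lemma adj_mono {k l : ℕ} (h : k ≤ l) : adj R T k ≤ adj R T l := by
  apply Algebra.adjoin_mono
  rintro x ⟨t, h1, rfl⟩
  exact ⟨t, by omega, rfl⟩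

/-- the span of `adj k` and `adj k * T_k * adj k` -/
def MM (R : Type) {H : Type} [CommRing R] [Ring H] [Algebra R H] (T : ℕ → H) (k : ℕ) :
    Submodule R H :=
  Subalgebra.toSubmodule (adj R T k) ⊔
    Submodule.span R {x | ∃ a ∈ adj R T k, ∃ b ∈ adj R T k, x = a * T k * b}

lemma MM_ind {k : ℕ} (P : Submodule R H) (h1 : ∀ a ∈ adj R T k, a ∈ P)
    (h2 : ∀ a ∈ adj R T k, ∀ b ∈ adj R T k, a * T k * b ∈ P) : MM R T k ≤ P := by
  refine sup_le (fun a ha => h1 a ha) (Submodule.span_le.2 ?_)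
  rintro x ⟨a, ha, b, hb, rfl⟩
  exact h2 a ha b hb

lemma MM_left {k : ℕ} {a : H} (ha : a ∈ adj R T k) : a ∈ MM R T k :=
  Submodule.mem_sup_left ha

lemma MM_right {k : ℕ} {a b : H} (ha : a ∈ adj R T k) (hb : b ∈ adj R T k) :
    a * T k * b ∈ MM R T k :=
  Submodule.mem_sup_right (Submodule.subset_span ⟨a, ha, b, hb, rfl⟩)

lemma adj_zero {x : H} (hx : x ∈ adj R T 0) : ∃ r : R, x = algebraMap R H r := by
  have : {x | ∃ t, t < 0 ∧ x = T t} = (∅ : Set H) := by ext; simp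
  rw [adj, this, Algebra.adjoin_empty] at hx
  obtain ⟨r, rfl⟩ := Algebra.mem_bot.1 hx
  exact ⟨r, rfl⟩

lemma adj_comm {k : ℕ} {x y : H} (hx : x ∈ adj R T k) (hy : ∀ t < k, Commute (T t) y) :
    Commute x y := by
  induction hx using Algebra.adjoin_induction with
  | mem x h => obtain ⟨t, h, rfl⟩ := h; exact hy t h
  | algebraMap r => exact Algebra.commutes r y
  | add _ _ _ _ h1 h2 => exact h1.add_left h2
  | mul _ _ _ _ h1 h2 => exact h1.mul_left h2

variable (hc : ∀ i j, i + 1 < j → Commute (T i) (T j))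
  (N : ℕ) (hb : ∀ i, i + 1 < N → T i * T (i+1) * T i = T (i+1) * T i * T (i+1))
  (A B : R) (hq : ∀ i, i < N → T i * T i = B • T i + algebraMap R H A)
include hc hb hq

lemma adj_le_MM (k : ℕ) (hk : k < N) : Subalgebra.toSubmodule (adj R T (k+1)) ≤ MM R T k := by
  induction k using Nat.strong_induction_on with
  | _ k ih =>
  -- left multiplication by `T_k` preserves `a * T_k * b`
  have key : ∀ a ∈ adj R T k, ∀ b ∈ adj R T k, T k * (a * T k * b) ∈ MM R T k := by
    intro a ha b hb'
    rcases k with _ | k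
    · obtain ⟨r, rfl⟩ := adj_zero T ha
      have e : T 0 * (algebraMap R H r * T 0 * b)
          = (B * r) • (1 * T 0 * b) + (A * r) • b := by
        rw [← Algebra.smul_def, smul_mul_assoc, mul_smul_comm, ← mul_assoc, hq 0 hk, add_mul,
          ← Algebra.smul_def, smul_add, smul_mul_assoc, one_mul, smul_smul, smul_smul,
          mul_comm r, mul_comm r]
      rw [e]
      exact add_mem (Submodule.smul_mem _ _ (MM_right T (one_mem _) hb'))
        (Submodule.smul_mem _ _ (MM_left T hb'))
    · have hT : ∀ c ∈ adj R T k, Commute c (T (k+1)) := fun c hc' =>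
        adj_comm T hc' fun t ht => hc _ _ (by omega)
      have up : adj R T k ≤ adj R T (k+1) := adj_mono T (by omega)
      let φ : H →ₗ[R] H := LinearMap.mulLeft R (T (k+1)) ∘ₗ LinearMap.mulRight R (T (k+1) * b)
      have hφ : ∀ x, φ x = T (k+1) * (x * (T (k+1) * b)) := fun x => rfl
      have : MM R T k ≤ (MM R T (k+1)).comap φ := by
        apply MM_ind
        · intro c hc'
          rw [Submodule.mem_comap, hφ]
          have e : T (k+1) * (c * (T (k+1) * b))
              = B • (c * T (k+1) * b) + A • (c * b) := by
            calc T (k+1) * (c * (T (k+1) * b)) = (T (k+1) * c) * T (k+1) * b := by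
                  simp only [mul_assoc]
              _ = c * (T (k+1) * T (k+1)) * b := by rw [← (hT c hc').eq]; simp only [mul_assoc]
              _ = _ := by
                rw [hq _ hk, mul_add, add_mul, ← Algebra.commutes, ← Algebra.smul_def]
                simp
          rw [e]
          exact add_mem (Submodule.smul_mem _ _ (MM_right T (up hc') hb'))
            (Submodule.smul_mem _ _ (MM_left T (mul_mem (up hc') hb')))
        · intro c hc' d hd
          rw [Submodule.mem_comap, hφ]
          have e : T (k+1) * (c * T k * d * (T (k+1) * b))
              = (c * T k) * T (k+1) * (T k * d * b) := by
            calc T (k+1) * (c * T k * d * (T (k+1) * b))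
                = (T (k+1) * c) * T k * (d * T (k+1)) * b := by simp only [mul_assoc]
              _ = c * (T (k+1) * T k * T (k+1)) * d * b := by
                  rw [← (hT c hc').eq, (hT d hd).eq]; simp only [mul_assoc]
              _ = _ := by rw [← hb k hk]; simp only [mul_assoc]
          rw [e]
          exact MM_right T (mul_mem (up hc') (T_adj T (by omega)))
            (mul_mem (mul_mem (T_adj T (by omega)) (up hd)) hb')
      have h2 := this (ih k (by omega) (by omega) ha)
      rw [Submodule.mem_comap, hφ] at h2
      simpa only [mul_assoc] using h2
  have step : ∀ t < k + 1, ∀ x ∈ MM R T k, T t * x ∈ MM R T k := by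
    intro t ht x hx
    have : MM R T k ≤ (MM R T k).comap (LinearMap.mulLeft R (T t)) := by
      rcases Nat.lt_or_ge t k with h | h
      · apply MM_ind
        · intro a ha
          exact MM_left T (mul_mem (T_adj T h) ha)
        · intro a ha b hb'
          rw [Submodule.mem_comap, LinearMap.mulLeft_apply, ← mul_assoc, ← mul_assoc]
          exact MM_right T (mul_mem (T_adj T h) ha) hb'
      · obtain rfl : t = k := by omega
        apply MM_ind
        · intro a ha
          rw [Submodule.mem_comap, LinearMap.mulLeft_apply, ← one_mul (T t)]
          exact MM_right T (one_mem _) ha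
        · intro a ha b hb'
          exact key a ha b hb'
    exact this hx
  rw [adj, Algebra.adjoin_eq_span, Submodule.span_le]
  intro x hx
  induction hx using Submonoid.closure_induction_left with
  | one => exact MM_left T (one_mem _)
  | mul_left x hx y _ hy =>
    obtain ⟨t, ht, rfl⟩ := hx
    exact step t ht y hy

variable (π : H →ₗ[R] V) (hπ : ∀ x y, π (x * y) = π (y * x))

/-- target span -/
def Tar (T : ℕ → H) (π : H →ₗ[R] V) (m : ℕ) (y : H) : Submodule R V :=
  Submodule.span R {v | ∃ L : List ℕ, L.sum = m ∧ (∀ a ∈ L, 0 < a) ∧ v = π (vl T 0 L * y)}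

include hπ

lemma main_span (m : ℕ) (hm : m ≤ N + 1) (y : H) (hy : ∀ t, t + 1 < m → Commute (T t) y)
    (h : H) (hh : h ∈ adj R T (m - 1)) : π (h * y) ∈ Tar T π m y := by
  induction m using Nat.strong_induction_on generalizing y h with
  | _ m ih =>
  rcases m with _ | m
  · obtain ⟨r, rfl⟩ := adj_zero T hh
    rw [← Algebra.smul_def, map_smul]
    exact Submodule.smul_mem _ _ (Submodule.subset_span ⟨[], rfl, by simp, by simp [vl]⟩)
  have claim : ∀ j, j ≤ m → ∀ h ∈ adj R T j,
      π (blk T j (m + 1 - j) * h * y) ∈ Tar T π (m+1) y := by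
    intro j
    induction j with
    | zero =>
      intro _ h hh
      obtain ⟨r, rfl⟩ := adj_zero T hh
      rw [← Algebra.commutes, mul_assoc, ← Algebra.smul_def, map_smul]
      exact Submodule.smul_mem _ _ (Submodule.subset_span ⟨[m+1], by simp, by simp, by simp [vl]⟩)
    | succ i ihi =>
      intro hi g hg
      obtain ⟨l, rfl⟩ : ∃ l, m = i + 1 + l := ⟨m - (i+1), by omega⟩
      have e1 : i + 1 + l + 1 - (i + 1) = l + 1 := by omega
      have e2 : i + 1 + l + 1 - i = l + 2 := by omega
      rw [e1]
      rw [e2] at ihi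
      have cy : ∀ c ∈ adj R T i, Commute c y := fun c hc' =>
        adj_comm T hc' fun t ht => hy t (by omega)
      have cb : ∀ c ∈ adj R T i, Commute c (blk T (i+1) (l+1)) := fun c hc' =>
        adj_comm T hc' fun t ht =>
          S_comm T hc (a := t) (b := i+1) le_rfl (T_mem T le_rfl (by omega)) (blk_mem T _ _)
      let φ : H →ₗ[R] V := π ∘ₗ LinearMap.mulRight R y ∘ₗ LinearMap.mulLeft R (blk T (i+1) (l+1))
      have hφ : ∀ x, φ x = π (blk T (i+1) (l+1) * x * y) := fun x => rfl
      have : MM R T i ≤ (Tar T π (i+1+l+1) y).comap φ := by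
        apply MM_ind
        · intro a ha
          rw [Submodule.mem_comap, hφ, ← (cb a ha).eq, mul_assoc]
          have h3 := ih (i+1) (by omega) (by omega) (blk T (i+1) (l+1) * y)
            (fun t ht => (cb (T t) (T_adj T (by omega))).mul_right (hy t (by omega))) a
            (by simpa using ha)
          refine (Submodule.span_le.2 ?_ : Tar T π (i+1) (blk T (i+1) (l+1) * y) ≤ _) h3
          rintro v ⟨L, hL, hpos, rfl⟩
          refine Submodule.subset_span ⟨L ++ [l+1], by simp [hL]; omega, ?_, ?_⟩
          · intro a ha
            rcases List.mem_append.1 ha with h | h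
            · exact hpos a h
            · simp at h; omega
          · rw [vl_append, hL, zero_add, mul_assoc]
        · intro a ha b hb'
          rw [Submodule.mem_comap, hφ]
          have h3 := ihi (by omega) (b * a) (mul_mem hb' ha)
          convert h3 using 1
          calc π (blk T (i+1) (l+1) * (a * T i * b) * y)
              = π ((blk T (i+1) (l+1) * a) * T i * (b * y)) := by simp only [mul_assoc]
            _ = π (a * (blk T (i+1) (l+1) * T i * y * b)) := by
                rw [← (cb a ha).eq, (cy b hb').eq]; simp only [mul_assoc]
            _ = π (blk T (i+1) (l+1) * T i * (y * (b * a))) := by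
                rw [hπ]; simp only [mul_assoc]
            _ = _ := by
                rw [← (cy _ (mul_mem hb' ha)).eq, ← blk_succ']; simp only [mul_assoc]
      exact this (adj_le_MM T hc N hb A B hq i (by omega) hg)
  have h4 := claim m le_rfl h (by simpa using hh)
  rwa [show m + 1 - m = 1 by omega, blk_one, one_mul] at h4

omit hq in
lemma perm_pi (hu : ∀ i, IsUnit (T i)) {L L' : List ℕ} (p : L.Perm L') (h : L.sum ≤ N + 1) :
    π (vl T 0 L) = π (vl T 0 L') := by
  obtain ⟨w, hw, e⟩ := vl_perm T hc N hb p 0 (by omega)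
  obtain ⟨u, rfl⟩ := S_unit T hu hw
  have : vl T 0 L = ↑u⁻¹ * (vl T 0 L' * u) := by rw [← e, Units.inv_mul_cancel_left]
  rw [this, hπ, mul_assoc, Units.mul_inv, mul_one]

end Alg

section Fin
variable (R : Type) [CommRing R] (A B : Rˣ) (n : ℕ)

lemma vList_eq (s : ℕ) (L : List ℕ) : vList R A B n s L = vl (Tn R A B n) s L := by
  induction L generalizing s with
  | nil => rfl
  | cons k L ih => rw [vList, vl, ih]; rfl

lemma Tn_comm (i j : ℕ) (h : i + 1 < j) : Commute (Tn R A B n i) (Tn R A B n j) := by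
  unfold Tn
  split_ifs with h1 h2
  · have := RingQuot.mkAlgHom_rel R (HeckeRel.comm (R := R) (A := A) (B := B) ⟨i, h1⟩ ⟨j, h2⟩ h)
    simp only [map_mul] at this
    exact this
  · exact Commute.one_right _
  · exact Commute.one_left _
  · exact Commute.one_left _

lemma Tn_braid (i : ℕ) (h : i + 1 < n - 1) :
    Tn R A B n i * Tn R A B n (i+1) * Tn R A B n i
      = Tn R A B n (i+1) * Tn R A B n i * Tn R A B n (i+1) := by
  have := RingQuot.mkAlgHom_rel R
    (HeckeRel.braid (R := R) (A := A) (B := B) ⟨i, by omega⟩ ⟨i+1, h⟩ rfl)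
  rw [Tn, dif_pos (by omega), Tn, dif_pos h]
  simp only [map_mul] at this
  exact this

lemma Tn_quad (i : ℕ) (h : i < n - 1) :
    Tn R A B n i * Tn R A B n i
      = (B : R) • Tn R A B n i + algebraMap R (Hecke R A B n) (A : R) := by
  have := RingQuot.mkAlgHom_rel R (HeckeRel.quad (R := R) (A := A) (B := B) ⟨i, h⟩)
  rw [Tn, dif_pos h]
  simp only [map_mul, map_add, map_smul, AlgHom.commutes] at this
  exact this

lemma Tn_unit (i : ℕ) : IsUnit (Tn R A B n i) := by
  by_cases h : i < n - 1
  · have q := Tn_quad R A B n i h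
    set t := Tn R A B n i
    have hA : ((A⁻¹ : Rˣ) : R) • algebraMap R (Hecke R A B n) (A : R) = 1 := by
      rw [Algebra.smul_def, ← map_mul, Units.inv_mul, map_one]
    have e1 : t * (((A⁻¹ : Rˣ) : R) • (t - algebraMap R _ (B : R))) = 1 := by
      rw [mul_smul_comm, mul_sub, q, ← Algebra.commutes, ← Algebra.smul_def, add_sub_cancel_left, hA]
    have e2 : (((A⁻¹ : Rˣ) : R) • (t - algebraMap R _ (B : R))) * t = 1 := by
      rw [smul_mul_assoc, sub_mul, q, ← Algebra.smul_def, add_sub_cancel_left, hA]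
    exact ⟨⟨t, _, e1, e2⟩, rfl⟩
  · rw [Tn, dif_neg h]; exact isUnit_one

lemma piV_comm (x y : Hecke R A B n) : piV R A B n (x * y) = piV R A B n (y * x) := by
  rw [← sub_eq_zero, ← map_sub]
  exact (Submodule.Quotient.mk_eq_zero _).2 (Submodule.subset_span ⟨x, y, rfl⟩)

lemma adj_top (x : Hecke R A B n) : x ∈ adj R (Tn R A B n) (n - 1) := by
  obtain ⟨f, rfl⟩ := RingQuot.mkAlgHom_surjective R (HeckeRel R A B n) x
  induction f using FreeAlgebra.induction with
  | grade0 r => rw [AlgHom.commutes]; exact Subalgebra.algebraMap_mem _ r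
  | grade1 i =>
    have := T_adj (R := R) (Tn R A B n) i.2
    rw [Tn, dif_pos i.2] at this
    exact this
  | mul a b ha hb => rw [map_mul]; exact mul_mem ha hb
  | add a b ha hb => rw [map_add]; exact add_mem ha hb

lemma span_top (hn : 1 ≤ n) : Submodule.span R
    (Set.range fun p : Nat.Partition n => piV R A B n (vPart R A B n p)) = ⊤ := by
  rw [eq_top_iff]
  rintro v -
  obtain ⟨x, rfl⟩ : ∃ x, piV R A B n x = v := Submodule.mkQ_surjective _ v
  have h := main_span (Tn R A B n) (Tn_comm R A B n) (n-1) (Tn_braid R A B n) (A : R) (B : R)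
    (Tn_quad R A B n) (piV R A B n) (piV_comm R A B n) n (by omega) 1
    (fun t _ => Commute.one_right _) x (adj_top R A B n x)
  rw [mul_one] at h
  refine (Submodule.span_le.2 ?_ : Tar (Tn R A B n) (piV R A B n) n 1 ≤ _) h
  rintro v ⟨L, hL, hpos, rfl⟩
  refine Submodule.subset_span ⟨⟨(L : Multiset ℕ), fun {i} hi => hpos i (by simpa using hi),
    by simpa using hL⟩, ?_⟩
  simp only [vPart, vList_eq, mul_one]
  refine (perm_pi (Tn R A B n) (Tn_comm R A B n) (n-1) (Tn_braid R A B n) (piV R A B n)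
    (piV_comm R A B n) (Tn_unit R A B n) ?_ (by omega)).symm
  rw [← Multiset.coe_eq_coe, Multiset.coe_reverse, Multiset.sort_eq]

end Fin
end HeckeAux

/-- The family `{π(v_λ)}`, as `λ` ranges over all partitions of `n`, spans
the `R`-module `V_n`; in particular, for every braid `β ∈ B_n` the class `π(ρ(β))` is an
`R`-linear combination of the classes `π(v_λ)`. -/
theorem vPart_span (R : Type) [CommRing R] [IsDomain R] (A B : Rˣ)
    (n : ℕ) (hn : 1 ≤ n) :
    Submodule.span R
        (Set.range fun p : Nat.Partition n => piV R A B n (vPart R A B n p)) = ⊤ ∧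
    ∀ ρ : BraidGroup n →* (Hecke R A B n)ˣ,
      (∀ i : Fin (n - 1),
          ((ρ (PresentedGroup.of i) : (Hecke R A B n)ˣ) : Hecke R A B n) = Tgen R A B n i) →
      ∀ β : BraidGroup n,
        piV R A B n ((ρ β : (Hecke R A B n)ˣ) : Hecke R A B n) ∈
          Submodule.span R
            (Set.range fun p : Nat.Partition n => piV R A B n (vPart R A B n p)) := by
  have h := HeckeAux.span_top R A B n hn
  exact ⟨h, fun ρ _ β => by rw [h]; exact Submodule.mem_top⟩
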